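/- arXiv:1209.4795 — 2 statements merged into one kernel-verified Lean document; each statement's English description precedes it below -/
import Mathlib

section
/- Let n ≥ 3, and let A₁, A₂, ..., A₂ₙ be 2n distinct points of ℙ²(ℂ) on an irreducible conic 𝒞. Let 𝒬₁, 𝒬₂, 𝒬₃ be three curves of degree n through all 2n points such that each of the three pairs (𝒬₂,𝒬₃), (𝒬₁,𝒬₃), (𝒬₁,𝒬₂) has defining polynomials with no common nonconstant factor and common zero set consisting of exactly n² distinct points (the 2n given points and n² − 2n residual points). Let 𝒞₁, 𝒞₂, 𝒞₃ be curves of degree n − 2 passing through the residual intersection points of the pairs (𝒬₂,𝒬₃), (𝒬₁,𝒬₃), (𝒬₁,𝒬₂) respectively, and assume that for each pair the degree-(n−2) curve through its residual points is unique up to a scalar. Then the defining degree-(n−2) polynomials of 𝒞₁, 𝒞₂ and 𝒞₃ are linearly dependent over ℂ, i.e. the three curves belong to one pencil. -/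
open MvPolynomial

noncomputable section

/-- Polynomials in three variables over `ℂ`. -/
abbrev Poly3 : Type := MvPolynomial (Fin 3) ℂ

/-- The complex projective plane `ℙ²(ℂ)`, the projectivization of `ℂ³`. -/
abbrev ProjPlane : Type := Projectivization ℂ (Fin 3 → ℂ)

/-- A (homogeneous) polynomial vanishes at a projective point if it vanishes at its
canonical nonzero representative vector (for homogeneous polynomials this is equivalent
to vanishing at any nonzero representative vector). -/
def VanishesAt (F : Poly3) (p : ProjPlane) : Prop :=
  MvPolynomial.eval p.rep F = 0

/-- The set of points of `ℙ²(ℂ)` at which `F` vanishes. -/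
def zeroSet (F : Poly3) : Set ProjPlane := {p | VanishesAt F p}

/-- Two defining polynomials give the same curve iff they are proportional by a
nonzero scalar. -/
def ProportionalTo (F G : Poly3) : Prop := ∃ c : ℂ, c ≠ 0 ∧ G = c • F

/-- A set of points is collinear if some nonzero homogeneous polynomial of degree 1
vanishes at all of them. -/
def Collin (s : Set ProjPlane) : Prop :=
  ∃ L : Poly3, L ≠ 0 ∧ L.IsHomogeneous 1 ∧ ∀ p ∈ s, VanishesAt L p

/-- No three distinct points of `s` are collinear. -/
def NoThreeCollinear (s : Set ProjPlane) : Prop :=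
  ∀ p q r, p ∈ s → q ∈ s → r ∈ s → p ≠ q → p ≠ r → q ≠ r → ¬ Collin {p, q, r}

/-- `L` is a (the) line through the points `p` and `q`. -/
def IsLineThrough (L : Poly3) (p q : ProjPlane) : Prop :=
  L ≠ 0 ∧ L.IsHomogeneous 1 ∧ VanishesAt L p ∧ VanishesAt L q

/-- `L` is the generalized Pascal line of the cubics `D₁` and `D₂` with respect to six
points `A, …, F`: the cubics have no common nonconstant factor, their common zero set
consists of exactly nine distinct points (the six given ones plus three further points),
and `L` is the line through the three further intersection points. -/
def IsGenPascalLine (A B C D E F : ProjPlane) (D₁ D₂ L : Poly3) : Prop :=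
  IsRelPrime D₁ D₂ ∧ L ≠ 0 ∧ L.IsHomogeneous 1 ∧
    ∃ P Q R : ProjPlane,
      ([A, B, C, D, E, F, P, Q, R] : List ProjPlane).Pairwise (· ≠ ·) ∧
      zeroSet D₁ ∩ zeroSet D₂ = {A, B, C, D, E, F, P, Q, R} ∧
      VanishesAt L P ∧ VanishesAt L Q ∧ VanishesAt L R

open Matrix

theorem exists_bilinForm_eval_eq {K : Poly3} (hK : K.IsHomogeneous 2) :
    ∃ B : LinearMap.BilinForm ℂ (Fin 3 → ℂ), ∀ v, eval v K = B v v := by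
  rw [← mem_homogeneousSubmodule, ← homogeneousSubmodule_one_pow, pow_two,
    homogeneousSubmodule_one_eq_span_X, Submodule.span_mul_span] at hK
  induction hK using Submodule.span_induction with
  | mem x hx =>
    obtain ⟨_, ⟨i, rfl⟩, _, ⟨j, rfl⟩, rfl⟩ := Set.mem_mul.1 hx
    exact ⟨(LinearMap.mul ℂ ℂ).compl₁₂ (LinearMap.proj i) (LinearMap.proj j), fun v => by simp⟩
  | zero => exact ⟨0, fun v => by simp⟩
  | add x y _ _ hx hy =>
    obtain ⟨B, hB⟩ := hx
    obtain ⟨B', hB'⟩ := hy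
    exact ⟨B + B', fun v => by simp [hB, hB']⟩
  | smul c x _ hx =>
    obtain ⟨B, hB⟩ := hx
    exact ⟨c • B, fun v => by simp [hB, smul_eval]⟩

theorem Irreducible.dvd_of_forall_eval_eq_zero {P F : Poly3} (hP : Irreducible P)
    (h : ∀ v, eval v P = 0 → eval v F = 0) : P ∣ F := by
  have hprime : (Ideal.span {P}).IsPrime :=
    (Ideal.span_singleton_prime hP.ne_zero).2 hP.prime
  rw [← Ideal.mem_span_singleton, ← MvPolynomial.IsPrime.vanishingIdeal_zeroLocus (K := ℂ) (Ideal.span {P})]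
  intro v hv
  exact h v (hv P (Ideal.mem_span_singleton_self P))

theorem linearIndependent_cons_of_crossProduct {u v x : Fin 3 → ℂ}
    (h : x ⬝ᵥ crossProduct u v ≠ 0) : LinearIndependent ℂ ![x, u, v] := by
  rw [triple_product_eq_det] at h
  exact Matrix.linearIndependent_rows_iff_isUnit.2
    ((Matrix.isUnit_iff_isUnit_det _).2 h.isUnit)

theorem mem_span_of_crossProduct_eq_zero {u v x : Fin 3 → ℂ}
    (huv : LinearIndependent ℂ ![u, v]) (h : x ⬝ᵥ crossProduct u v = 0) :
    ∃ a b : ℂ, x = a • u + b • v := by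
  by_contra hx
  have hli : LinearIndependent ℂ ![x, u, v] := by
    refine linearIndependent_finCons.2 ⟨huv, fun hmem => hx ?_⟩
    rw [Matrix.range_cons, Matrix.range_cons, Matrix.range_empty, Set.union_empty,
      Set.singleton_union, Submodule.mem_span_pair] at hmem
    obtain ⟨a, b, hab⟩ := hmem
    exact ⟨a, b, hab.symm⟩
  have hdet : IsUnit (Matrix.det ![x, u, v]) := (Matrix.isUnit_iff_isUnit_det _).1
    (Matrix.linearIndependent_rows_iff_isUnit.1 hli)
  rw [triple_product_eq_det] at h
  exact hdet.ne_zero h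

/-- The linear form with coefficient vector `c`. -/
def linForm (c : Fin 3 → ℂ) : Poly3 := ∑ i, C (c i) * X i

theorem eval_linForm (c v : Fin 3 → ℂ) : eval v (linForm c) = v ⬝ᵥ c := by
  simp [linForm, dotProduct, mul_comm]

theorem linForm_isHomogeneous (c : Fin 3 → ℂ) : (linForm c).IsHomogeneous 1 :=
  IsHomogeneous.sum _ _ _ fun i _ => isHomogeneous_C_mul_X (c i) i

theorem linForm_ne_zero {c : Fin 3 → ℂ} (hc : c ≠ 0) : linForm c ≠ 0 := by
  intro h
  refine hc (dotProduct_eq_zero_iff.1 fun v => ?_)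
  rw [dotProduct_comm, ← eval_linForm, h, map_zero]

theorem irreducible_linForm {c : Fin 3 → ℂ} (hc : c ≠ 0) : Irreducible (linForm c) := by
  refine irreducible_of_totalDegree_eq_one
    ((linForm_isHomogeneous c).totalDegree (linForm_ne_zero hc)) fun x hx => ?_
  rw [isUnit_iff_ne_zero]
  rintro rfl
  exact linForm_ne_zero hc (MvPolynomial.ext _ _ fun m => by simpa using hx m)

theorem not_conic_dvd_linForm {K : Poly3} (hK : K.IsHomogeneous 2) {c : Fin 3 → ℂ} (hc : c ≠ 0) :
    ¬ K ∣ linForm c := by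
  intro h
  have hK0 : K ≠ 0 := ne_zero_of_dvd_ne_zero (linForm_ne_zero hc) h
  have := totalDegree_le_of_dvd_of_isDomain h (linForm_ne_zero hc)
  rw [hK.totalDegree hK0, (linForm_isHomogeneous c).totalDegree (linForm_ne_zero hc)] at this
  omega

/-- An irreducible conic contains no line. -/
theorem polar_ne_zero_of_linearIndependent {K : Poly3} (hKh : K.IsHomogeneous 2)
    (hK : Irreducible K) {B : LinearMap.BilinForm ℂ (Fin 3 → ℂ)} (hB : ∀ v, eval v K = B v v)
    {u v : Fin 3 → ℂ} (huv : LinearIndependent ℂ ![u, v]) (hu : eval u K = 0)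
    (hv : eval v K = 0) : B u v + B v u ≠ 0 := by
  intro h
  have hc : crossProduct u v ≠ 0 := crossProduct_ne_zero_iff_linearIndependent.2 huv
  have hdvd : linForm (crossProduct u v) ∣ K := by
    refine (irreducible_linForm hc).dvd_of_forall_eval_eq_zero fun x hx => ?_
    rw [eval_linForm] at hx
    obtain ⟨a, b, rfl⟩ := mem_span_of_crossProduct_eq_zero huv hx
    rw [hB] at hu hv ⊢
    simp only [map_add, map_smul, LinearMap.add_apply, LinearMap.smul_apply, smul_eq_mul]
    linear_combination a * a * hu + b * b * hv + a * b * h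
  refine not_conic_dvd_linForm hKh hc ?_
  exact ((irreducible_linForm hc).associated_of_dvd hK hdvd).symm.dvd

theorem exists_linForm_eval_eq_zero (u : Fin 3 → ℂ) :
    ∃ c : Fin 3 → ℂ, c ≠ 0 ∧ eval u (linForm c) = 0 := by
  by_cases h : u 0 = 0
  · exact ⟨![1, 0, 0], fun hc => by simpa using congrFun hc 0,
      by simp [eval_linForm, dotProduct, Fin.sum_univ_three, h]⟩
  · exact ⟨![u 1, - u 0, 0], fun hc => h (by simpa using congrFun hc 1),
      by simp [eval_linForm, dotProduct, Fin.sum_univ_three]; ring⟩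


theorem eval_smul_of_isHomogeneous {F : Poly3} {m : ℕ} (hF : F.IsHomogeneous m)
    (c : ℂ) (v : Fin 3 → ℂ) : eval (c • v) F = c ^ m * eval v F := by
  rw [eval_eq, eval_eq, Finset.mul_sum]
  refine Finset.sum_congr rfl fun d hd => ?_
  simp only [Pi.smul_apply, smul_eq_mul, mul_pow, Finset.prod_mul_distrib, Finset.prod_pow_eq_pow_sum]
  rw [← hF.degree_eq_sum_deg_support hd]
  ring

theorem exists_spanning_triple {u w : Fin 3 → ℂ} (h : LinearIndependent ℂ ![u, w]) :
    ∃ x : Fin 3 → ℂ, ∀ v, ∃ a b c : ℂ, v = a • x + b • u + c • w := by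
  obtain ⟨x, hx⟩ : ∃ x, x ⬝ᵥ crossProduct u w ≠ 0 := by
    by_contra! h0
    exact crossProduct_ne_zero_iff_linearIndependent.2 h
      (dotProduct_eq_zero_iff.1 fun x => by rw [dotProduct_comm, h0])
  have hli := linearIndependent_cons_of_crossProduct hx
  refine ⟨x, fun v => ?_⟩
  have hspan := hli.span_eq_top_of_card_eq_finrank (by simp)
  obtain ⟨f, hf⟩ := (Submodule.mem_span_range_iff_exists_fun ℂ).1
    (hspan ▸ Submodule.mem_top : v ∈ _)
  exact ⟨f 0, f 1, f 2, by rw [← hf]; simp [Fin.sum_univ_three]⟩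

theorem linearIndependent_rep {p q : ProjPlane} (h : p ≠ q) :
    LinearIndependent ℂ ![p.rep, q.rep] := by
  have := Projectivization.independent_iff.1 ((Projectivization.independent_pair_iff_ne p q).2 h)
  have h2 : Projectivization.rep ∘ ![p, q] = ![p.rep, q.rep] := by
    ext i
    fin_cases i <;> rfl
  rwa [h2] at this

theorem eq_of_rep_eq_smul {p q : ProjPlane} {x : Fin 3 → ℂ} {a b : ℂ} (hb : b ≠ 0)
    (hp : p.rep = a • x) (hq : q.rep = b • x) : p = q := by
  by_contra h
  have := (LinearIndependent.pair_iff.1 (linearIndependent_rep h)) b (-a)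
    (by rw [hp, hq, smul_smul, smul_smul, ← add_smul]; simp [mul_comm])
  exact hb this.1

theorem conic_dvd_of_base_point {K : Poly3} (hKh : K.IsHomogeneous 2) (hK : Irreducible K)
    {F : Poly3} {n : ℕ} (hF : F.IsHomogeneous n) {S : Finset ProjPlane}
    (hSK : ∀ p ∈ S, VanishesAt K p) (hSF : ∀ p ∈ S, VanishesAt F p) (hcard : 2 * n < S.card)
    {o : ProjPlane} (ho : VanishesAt K o) (hoS : o ∉ S) : K ∣ F := by
  obtain ⟨B, hB⟩ := exists_bilinForm_eval_eq hKh
  set u := o.rep with hu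
  have hKu : B u u = 0 := by rw [← hB]; exact ho
  let l : (Fin 3 → ℂ) →ₗ[ℂ] ℂ := B u + B.flip u
  have hl : ∀ v, l v = B u v + B v u := fun v => rfl
  have hlS : ∀ p ∈ S, l p.rep ≠ 0 := fun p hp =>
    polar_ne_zero_of_linearIndependent hKh hK hB
      (linearIndependent_rep fun h => hoS (h ▸ hp)) ho (hSK p hp)
  obtain ⟨q, hq⟩ : S.Nonempty := Finset.card_pos.1 (by omega)
  obtain ⟨x, hx⟩ := exists_spanning_triple
    (linearIndependent_rep (p := o) (q := q) fun h => hoS (h ▸ hq))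
  have hlq := hlS q hq
  obtain ⟨w, hw⟩ : ∃ w, w = (l q.rep)⁻¹ • q.rep := ⟨_, rfl⟩
  have hlw : l w = 1 := by rw [hw, map_smul, smul_eq_mul, inv_mul_cancel₀ hlq]
  have hqw : q.rep = l q.rep • w := by rw [hw, smul_smul, mul_inv_cancel₀ hlq, one_smul]
  have hlu : l u = 0 := by rw [hl, hKu, add_zero]
  obtain ⟨t, ht⟩ : ∃ t, t = x - l x • w := ⟨_, rfl⟩
  have hlt : l t = 0 := by rw [ht, map_sub, map_smul, hlw]; simp
  have hdecomp : ∀ v, ∃ a b : ℂ, v = a • u + b • t + l v • w := by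
    intro v
    obtain ⟨a, b, c, hv⟩ := hx v
    rw [hqw] at hv
    have hlv : l v = a * l x + c * l q.rep := by
      rw [hv]; simp [hlw, hlu, hu.symm]
    refine ⟨b, a, ?_⟩
    rw [hlv, ht, hv]
    module
  -- the parametrization of the conic by the lines through the base point
  let φ : ℂ → Fin 3 → ℂ := fun s => -(B (s • t + w) (s • t + w)) • u + s • t + w
  have hφ : ∀ v, eval v K = 0 → l v ≠ 0 → ∃ s, v = l v • φ s := by
    intro v hv hlv
    obtain ⟨a, b, hab⟩ := hdecomp v
    refine ⟨b / l v, ?_⟩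
    set c := l v
    have hBu : ∀ y, B u y = l y - B y u := fun y => by rw [hl]; ring
    have key : a = -c * B ((b / c) • t + w) ((b / c) • t + w) := by
      rw [hB, hab] at hv
      simp only [map_add, map_smul, LinearMap.add_apply, LinearMap.smul_apply, smul_eq_mul, hKu,
        hBu, hlt, hlw] at hv ⊢
      field_simp
      linear_combination hv
    have hb : b = c * (b / c) := by field_simp
    rw [hab]
    simp only [φ]
    rw [key]
    nth_rewrite 3 [hb]
    module
  let ψ : Fin 3 → Polynomial ℂ := fun i =>
    -(Polynomial.C (B t t) * Polynomial.X ^ 2 + Polynomial.C (B t w + B w t) * Polynomial.X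
      + Polynomial.C (B w w)) * Polynomial.C (u i) + Polynomial.C (t i) * Polynomial.X
      + Polynomial.C (w i)
  have hψ : ∀ s i, (ψ i).eval s = φ s i := by
    intro s i
    simp [ψ, φ]
    ring
  have hψdeg : ∀ i, (ψ i).natDegree ≤ 2 := by
    intro i
    simp only [ψ]
    compute_degree
  have heval : ∀ s, (aeval ψ F).eval s = eval (φ s) F := by
    intro s
    have h := map_aeval ψ (Polynomial.evalRingHom s) F
    simp only [Polynomial.coe_evalRingHom, hψ] at h
    have hid : (Polynomial.evalRingHom s).comp (algebraMap ℂ (Polynomial ℂ)) = RingHom.id ℂ :=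
      RingHom.ext fun z => by simp
    rw [h, hid]
    rfl
  choose σ hσ using fun p : S => hφ p.1.rep (hSK p.1 p.2) (hlS p.1 p.2)
  have hzero : aeval ψ F = 0 := by
    refine Polynomial.eq_zero_of_natDegree_lt_card_of_eval_eq_zero _ (f := σ) ?_ ?_ ?_
    · intro p p' hpp'
      exact Subtype.ext (eq_of_rep_eq_smul (hlS p'.1 p'.2) (hσ p) (hpp' ▸ hσ p'))
    · intro p
      have h := hSF p.1 p.2
      rw [VanishesAt, hσ p, eval_smul_of_isHomogeneous hF] at h
      rw [heval]
      exact (mul_eq_zero.1 h).resolve_left (pow_ne_zero _ (hlS p.1 p.2))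
    · rw [Fintype.card_coe]
      exact (aeval_natDegree_le F hF.totalDegree_le ψ hψdeg).trans_lt (by omega)
  let c : Fin 3 → ℂ := fun i => l (Pi.single i 1)
  have hc : ∀ v, eval v (linForm c) = l v := by
    intro v
    rw [eval_linForm, dotProduct, l.pi_apply_eq_sum_univ v]
    refine Finset.sum_congr rfl fun i _ => ?_
    rw [smul_eq_mul]
    exact congrArg (fun y => v i * l y) (funext fun j => by simp [Pi.single_apply, eq_comm])
  have hdvd : K ∣ F * linForm c := by
    refine hK.dvd_of_forall_eval_eq_zero fun v hv => ?_
    rw [map_mul, hc]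
    by_cases hlv : l v = 0
    · rw [hlv, mul_zero]
    · obtain ⟨s, hs⟩ := hφ v hv hlv
      rw [hs, eval_smul_of_isHomogeneous hF, ← heval, hzero, Polynomial.eval_zero, mul_zero,
        zero_mul]
  refine (hK.prime.dvd_or_dvd hdvd).resolve_right (not_conic_dvd_linForm hKh fun h0 => hlq ?_)
  rw [← hc, h0]
  simp [eval_linForm]

theorem exists_conic_point_notMem {K : Poly3} (hKh : K.IsHomogeneous 2) (hK : Irreducible K)
    (S : Finset ProjPlane) : ∃ o, o ∉ S ∧ VanishesAt K o := by
  by_contra! h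
  choose c hc0 hc using fun p : ProjPlane => exists_linForm_eval_eq_zero p.rep
  have he : (Pi.single 0 1 : Fin 3 → ℂ) ≠ 0 := by simp
  have hdvd : K ∣ linForm (Pi.single 0 1) * ∏ p ∈ S, linForm (c p) := by
    refine hK.dvd_of_forall_eval_eq_zero fun v hv => ?_
    rw [map_mul]
    by_cases hv0 : v = 0
    · rw [eval_linForm, hv0, zero_dotProduct, zero_mul]
    obtain ⟨a, ha⟩ := Projectivization.exists_smul_eq_mk_rep ℂ v hv0
    have hmem : Projectivization.mk ℂ v hv0 ∈ S := by
      by_contra hS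
      refine h _ hS ?_
      rw [VanishesAt, ← ha, Units.smul_def, eval_smul_of_isHomogeneous hKh, hv, mul_zero]
    rw [map_prod, Finset.prod_eq_zero hmem, mul_zero]
    have := hc (Projectivization.mk ℂ v hv0)
    rw [← ha, Units.smul_def, eval_smul_of_isHomogeneous (linForm_isHomogeneous _)] at this
    exact (mul_eq_zero.1 this).resolve_left (pow_ne_zero _ a.ne_zero)
  rcases hK.prime.dvd_or_dvd hdvd with h1 | h1
  · exact not_conic_dvd_linForm hKh he h1
  · obtain ⟨p, _, hp⟩ := hK.prime.exists_mem_finset_dvd h1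
    exact not_conic_dvd_linForm hKh (hc0 p) hp

/-- A curve of degree `n` meeting an irreducible conic in more than `2n` points contains it. -/
theorem conic_dvd_of_card {K : Poly3} (hKh : K.IsHomogeneous 2) (hK : Irreducible K)
    {F : Poly3} {n : ℕ} (hF : F.IsHomogeneous n) {S : Finset ProjPlane}
    (hSK : ∀ p ∈ S, VanishesAt K p) (hSF : ∀ p ∈ S, VanishesAt F p)
    (hcard : 2 * n < S.card) : K ∣ F := by
  obtain ⟨o, hoS, ho⟩ := exists_conic_point_notMem hKh hK S
  exact conic_dvd_of_base_point hKh hK hF hSK hSF hcard ho hoS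

theorem exists_homogeneous_cofactor {K H : Poly3} {k n : ℕ} (hKh : K.IsHomogeneous k)
    (hH : H.IsHomogeneous n) (hk : k ≤ n) (h : K ∣ H) :
    ∃ D : Poly3, D.IsHomogeneous (n - k) ∧ K * D = H := by
  obtain ⟨G, rfl⟩ := h
  let _ : GradedAlgebra (homogeneousSubmodule (Fin 3) ℂ) := MvPolynomial.gradedAlgebra
  have h := DirectSum.coe_decompose_mul_of_left_mem_of_le (homogeneousSubmodule (Fin 3) ℂ)
    (b := G) hKh hk
  rw [DirectSum.decompose_of_mem_same _ hH] at h
  exact ⟨_, (DirectSum.decompose (homogeneousSubmodule (Fin 3) ℂ) G (n - k)).2, h.symm⟩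

theorem not_isUnit_of_isHomogeneous {F : Poly3} {n : ℕ} (hn : n ≠ 0) (hF : F.IsHomogeneous n)
    (hF0 : F ≠ 0) : ¬ IsUnit F := fun h =>
  hn ((hF.totalDegree hF0).symm.trans (isUnit_iff_totalDegree_of_isReduced.1 h).2)

/-- Two curves of degree `n` through the same `2n` points of an irreducible conic `K` span a
pencil containing a reducible curve `K * D`; the curve `D` passes through the residual
intersection points. -/
theorem exists_residual_curve {n : ℕ} (hn : 2 ≤ n) {A : Fin (2 * n) → ProjPlane}
    (hA : Function.Injective A) {K : Poly3} (hKh : K.IsHomogeneous 2) (hK : Irreducible K)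
    (honK : ∀ i, VanishesAt K (A i)) {o : ProjPlane} (ho : VanishesAt K o)
    (hoA : ∀ i, o ≠ A i) {F G : Poly3}
    (hF : F ≠ 0 ∧ F.IsHomogeneous n ∧ ∀ i, VanishesAt F (A i))
    (hG : G ≠ 0 ∧ G.IsHomogeneous n ∧ ∀ i, VanishesAt G (A i)) (hrel : IsRelPrime F G) :
    ∃ D : Poly3, D ≠ 0 ∧ D.IsHomogeneous (n - 2) ∧
      K * D = eval o.rep G • F - eval o.rep F • G ∧
      ∀ p, (∀ i, p ≠ A i) → VanishesAt F p → VanishesAt G p → VanishesAt D p := by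
  obtain ⟨hF0, hFh, hFA⟩ := hF
  obtain ⟨hG0, hGh, hGA⟩ := hG
  have hdvd : ∀ {H : Poly3}, H.IsHomogeneous n → (∀ i, VanishesAt H (A i)) →
      ∀ {p}, (∀ i, p ≠ A i) → VanishesAt K p → VanishesAt H p → K ∣ H := by
    intro H hH hHA p hpA hpK hpH
    have hp : p ∉ Finset.univ.map ⟨A, hA⟩ := by
      simpa using fun i => (hpA i).symm
    refine conic_dvd_of_card hKh hK hH (S := Finset.cons p _ hp) ?_ ?_ ?_
    · simpa using ⟨hpK, honK⟩
    · simpa using ⟨hpH, hHA⟩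
    · simp
  have hmem : ∀ a b : ℂ, (a • F - b • G).IsHomogeneous n := fun a b =>
    (homogeneousSubmodule (Fin 3) ℂ n).sub_mem
      (Submodule.smul_mem _ a hFh) (Submodule.smul_mem _ b hGh)
  obtain ⟨D, hDh, hD⟩ := exists_homogeneous_cofactor hKh
    (hmem (eval o.rep G) (eval o.rep F)) hn (hdvd (hmem _ _) (fun i => by
      have h1 := hFA i
      have h2 := hGA i
      simp only [VanishesAt] at h1 h2 ⊢
      simp [smul_eval, h1, h2]) hoA ho (by simp [VanishesAt, smul_eval, mul_comm]))
  refine ⟨D, ?_, hDh, hD, fun p hpA hpF hpG => ?_⟩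
  · rintro rfl
    rw [mul_zero, eq_comm, sub_eq_zero] at hD
    by_cases hGo : eval o.rep G = 0
    · by_cases hFo : eval o.rep F = 0
      · exact hK.not_isUnit (hrel (hdvd hFh hFA hoA ho hFo) (hdvd hGh hGA hoA ho hGo))
      · rw [hGo, zero_smul, eq_comm, smul_eq_zero] at hD
        exact hD.elim hFo hG0
    · have hFG : F = C ((eval o.rep G)⁻¹ * eval o.rep F) * G := by
        rw [← smul_eq_C_mul, mul_smul, ← hD, inv_smul_smul₀ hGo]
      exact not_isUnit_of_isHomogeneous (by omega) hGh hG0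
        (hrel (hFG ▸ dvd_mul_left G _) dvd_rfl)
  · have hpK : ¬ VanishesAt K p := fun hpK =>
      hK.not_isUnit (hrel (hdvd hFh hFA hpA hpK hpF) (hdvd hGh hGA hpA hpK hpG))
    have h := congrArg (eval p.rep) hD
    simp only [VanishesAt] at hpF hpG
    rw [map_mul, map_sub, smul_eval, smul_eval, hpF, hpG, mul_zero, mul_zero, sub_zero] at h
    exact (mul_eq_zero.1 h).resolve_left hpK

/-- A `2n`-gon inscribed in an irreducible conic: if `𝒬₁`, `𝒬₂`, `𝒬₃` are three
degree-`n` curves through all `2n` vertices, each pair meeting in exactly `n²` distinct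
points, and `𝒞₁`, `𝒞₂`, `𝒞₃` are the degree-`(n-2)` curves through the residual
intersection points of the pairs `(𝒬₂,𝒬₃)`, `(𝒬₁,𝒬₃)`, `(𝒬₁,𝒬₂)` (each unique up
to a scalar), then `𝒞₁`, `𝒞₂`, `𝒞₃` belong to one pencil: their defining polynomials
are linearly dependent over `ℂ`. -/
theorem mystic_2n_gon_pencil (n : ℕ) (hn : 3 ≤ n)
    (A : Fin (2 * n) → ProjPlane) (hA : Function.Injective A)
    (K : Poly3) (hKh : K.IsHomogeneous 2) (hKirr : Irreducible K)
    (honK : ∀ i, VanishesAt K (A i))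
    (Q₁ Q₂ Q₃ : Poly3)
    (hQ : ∀ Qi ∈ [Q₁, Q₂, Q₃], Qi ≠ 0 ∧ Qi.IsHomogeneous n ∧
      ∀ i, VanishesAt Qi (A i))
    (r₁ r₂ r₃ : Fin (n ^ 2 - 2 * n) → ProjPlane)
    (hr₁ : Function.Injective r₁) (hr₂ : Function.Injective r₂)
    (hr₃ : Function.Injective r₃)
    (hd₁ : ∀ i j, r₁ i ≠ A j) (hd₂ : ∀ i j, r₂ i ≠ A j) (hd₃ : ∀ i j, r₃ i ≠ A j)
    (hrel₁ : IsRelPrime Q₂ Q₃) (hrel₂ : IsRelPrime Q₁ Q₃) (hrel₃ : IsRelPrime Q₁ Q₂)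
    (hz₁ : zeroSet Q₂ ∩ zeroSet Q₃ = Set.range A ∪ Set.range r₁)
    (hz₂ : zeroSet Q₁ ∩ zeroSet Q₃ = Set.range A ∪ Set.range r₂)
    (hz₃ : zeroSet Q₁ ∩ zeroSet Q₂ = Set.range A ∪ Set.range r₃)
    (C₁ C₂ C₃ : Poly3)
    (hC₁ : C₁ ≠ 0 ∧ C₁.IsHomogeneous (n - 2) ∧ ∀ i, VanishesAt C₁ (r₁ i))
    (hC₂ : C₂ ≠ 0 ∧ C₂.IsHomogeneous (n - 2) ∧ ∀ i, VanishesAt C₂ (r₂ i))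
    (hC₃ : C₃ ≠ 0 ∧ C₃.IsHomogeneous (n - 2) ∧ ∀ i, VanishesAt C₃ (r₃ i))
    (hU₁ : ∀ C' : Poly3, C' ≠ 0 → C'.IsHomogeneous (n - 2) →
      (∀ i, VanishesAt C' (r₁ i)) → ∃ c : ℂ, C' = c • C₁)
    (hU₂ : ∀ C' : Poly3, C' ≠ 0 → C'.IsHomogeneous (n - 2) →
      (∀ i, VanishesAt C' (r₂ i)) → ∃ c : ℂ, C' = c • C₂)
    (hU₃ : ∀ C' : Poly3, C' ≠ 0 → C'.IsHomogeneous (n - 2) →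
      (∀ i, VanishesAt C' (r₃ i)) → ∃ c : ℂ, C' = c • C₃) :
    ∃ a b c : ℂ, ¬(a = 0 ∧ b = 0 ∧ c = 0) ∧ a • C₁ + b • C₂ + c • C₃ = 0 := by
  obtain ⟨o, hoS, ho⟩ := exists_conic_point_notMem hKh hKirr (Finset.univ.map ⟨A, hA⟩)
  have hoA : ∀ i, o ≠ A i := fun i h => hoS (by simp [h])
  have hQ₁ := hQ Q₁ (by simp)
  have hQ₂ := hQ Q₂ (by simp)
  have hQ₃ := hQ Q₃ (by simp)
  have hn2 : 2 ≤ n := by omega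
  obtain ⟨D₁, hD₁0, hD₁h, hD₁, hD₁r⟩ :=
    exists_residual_curve hn2 hA hKh hKirr honK ho hoA hQ₂ hQ₃ hrel₁
  obtain ⟨D₂, hD₂0, hD₂h, hD₂, hD₂r⟩ :=
    exists_residual_curve hn2 hA hKh hKirr honK ho hoA hQ₁ hQ₃ hrel₂
  obtain ⟨D₃, hD₃0, hD₃h, hD₃, hD₃r⟩ :=
    exists_residual_curve hn2 hA hKh hKirr honK ho hoA hQ₁ hQ₂ hrel₃
  have hmem : ∀ {F G : Poly3} {r : Fin (n ^ 2 - 2 * n) → ProjPlane},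
      zeroSet F ∩ zeroSet G = Set.range A ∪ Set.range r → ∀ i, VanishesAt F (r i) ∧
        VanishesAt G (r i) := fun hz i =>
    hz.symm.subset (Or.inr ⟨i, rfl⟩)
  obtain ⟨d₁, rfl⟩ := hU₁ D₁ hD₁0 hD₁h fun i => hD₁r _ (hd₁ i) (hmem hz₁ i).1 (hmem hz₁ i).2
  obtain ⟨d₂, rfl⟩ := hU₂ D₂ hD₂0 hD₂h fun i => hD₂r _ (hd₂ i) (hmem hz₂ i).1 (hmem hz₂ i).2
  obtain ⟨d₃, rfl⟩ := hU₃ D₃ hD₃0 hD₃h fun i => hD₃r _ (hd₃ i) (hmem hz₃ i).1 (hmem hz₃ i).2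
  have hd₁0 := (smul_ne_zero_iff.1 hD₁0).1
  have hd₂0 := (smul_ne_zero_iff.1 hD₂0).1
  refine ⟨eval o.rep Q₁ * d₁, -(eval o.rep Q₂ * d₂), eval o.rep Q₃ * d₃, ?_, ?_⟩
  · rintro ⟨h1, h2, -⟩
    have hq₁ := (mul_eq_zero.1 h1).resolve_right hd₁0
    have hq₂ := (mul_eq_zero.1 (neg_eq_zero.1 h2)).resolve_right hd₂0
    rw [hq₁, hq₂, zero_smul, zero_smul, sub_zero] at hD₃
    exact mul_ne_zero hKirr.ne_zero hD₃0 hD₃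
  · refine (mul_eq_zero.1 ?_).resolve_left hKirr.ne_zero
    simp only [smul_eq_C_mul, C_mul, C_neg] at hD₁ hD₂ hD₃ ⊢
    linear_combination C (eval o.rep Q₁) * hD₁ - C (eval o.rep Q₂) * hD₂
      + C (eval o.rep Q₃) * hD₃
end
end

section
/- Let A, B, C, D be four distinct points of ℙ²(ℂ), no three collinear, lying on an irreducible conic 𝒞 with defining polynomial F. Assume l(AD) ≠ l(BC) and l(AB) ≠ l(CD), and let M = l(AD) ∩ l(BC) and N = l(AB) ∩ l(CD). Let the tangent lines to 𝒞 at A, B, C, D be the lines defined by the linear forms x·∂F/∂x(v) + y·∂F/∂y(v) + z·∂F/∂z(v) for representative vectors v of A, B, C, D respectively (each assumed nonzero). Assume the tangents at A and at C are distinct and meet at P, and the tangents at B and at D are distinct and meet at Q. Then the four points M, N, P and Q are collinear. -/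
open MvPolynomial

noncomputable section

/-- The tangent line to the curve `F = 0` at a point with representative vector `v` is
given by the linear form `x·∂F/∂x(v) + y·∂F/∂y(v) + z·∂F/∂z(v)`. -/
def tangentForm (F : Poly3) (v : Fin 3 → ℂ) : Poly3 :=
  MvPolynomial.C (MvPolynomial.eval v (MvPolynomial.pderiv 0 F)) * MvPolynomial.X 0 +
  MvPolynomial.C (MvPolynomial.eval v (MvPolynomial.pderiv 1 F)) * MvPolynomial.X 1 +
  MvPolynomial.C (MvPolynomial.eval v (MvPolynomial.pderiv 2 F)) * MvPolynomial.X 2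

lemma pderiv_comm {σ R : Type*} [CommRing R] (i j : σ) (p : MvPolynomial σ R) :
    pderiv i (pderiv j p) = pderiv j (pderiv i p) := by
  classical
  have h : ⁅(pderiv i : Derivation R (MvPolynomial σ R) (MvPolynomial σ R)),
      (pderiv j : Derivation R (MvPolynomial σ R) (MvPolynomial σ R))⁆ = 0 := by
    refine MvPolynomial.derivation_ext fun k => ?_
    rw [Derivation.commutator_apply, pderiv_X, pderiv_X]
    simp [Pi.single_apply, apply_ite]
  have h' := DFunLike.congr_fun h p
  rwa [Derivation.commutator_apply, Derivation.zero_apply, sub_eq_zero] at h'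

lemma eval_eq_sum_of_isHomogeneous_one {L : Poly3} (hL : L.IsHomogeneous 1) (v : Fin 3 → ℂ) :
    eval v L = v 0 * constantCoeff (pderiv 0 L) + v 1 * constantCoeff (pderiv 1 L)
      + v 2 * constantCoeff (pderiv 2 L) := by
  have hC (i : Fin 3) : eval v (pderiv i L) = constantCoeff (pderiv i L) := by
    have h := hL.pderiv (i := i)
    rw [← totalDegree_zero_iff_isHomogeneous, totalDegree_eq_zero_iff_eq_C] at h
    rw [h]
    simp
  have h := congrArg (eval v) hL.sum_X_mul_pderiv
  simpa [Fin.sum_univ_three, hC] using h.symm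

/-- A linear form evaluates linearly. -/
lemma exists_linearMap_eval {L : Poly3} (hL : L.IsHomogeneous 1) :
    ∃ f : (Fin 3 → ℂ) →ₗ[ℂ] ℂ, ∀ v, eval v L = f v := by
  refine ⟨∑ i, constantCoeff (pderiv i L) • LinearMap.proj i, fun v => ?_⟩
  rw [eval_eq_sum_of_isHomogeneous_one hL]
  simp [Fin.sum_univ_three]
  ring

lemma isHomogeneous_tangentForm (F : Poly3) (v : Fin 3 → ℂ) :
    (tangentForm F v).IsHomogeneous 1 :=
  ((isHomogeneous_C_mul_X _ _).add (isHomogeneous_C_mul_X _ _)).add (isHomogeneous_C_mul_X _ _)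

/-- The tangent forms of a conic are given by a symmetric bilinear form, whose quadratic form
is twice the defining polynomial. -/
lemma exists_polar_form {F : Poly3} (hF : F.IsHomogeneous 2) :
    ∃ S : (Fin 3 → ℂ) →ₗ[ℂ] (Fin 3 → ℂ) →ₗ[ℂ] ℂ, (∀ v w, S v w = S w v) ∧
      (∀ v, S v v = 2 * eval v F) ∧ ∀ v w, eval w (tangentForm F v) = S v w := by
  set H : Matrix (Fin 3) (Fin 3) ℂ :=
    Matrix.of fun i j => constantCoeff (pderiv i (pderiv j F)) with hH
  have hsymm (i j : Fin 3) : H i j = H j i := by simp [hH, pderiv_comm i j]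
  have hpderiv (i : Fin 3) (v : Fin 3 → ℂ) :
      eval v (pderiv i F) = v 0 * H 0 i + v 1 * H 1 i + v 2 * H 2 i :=
    eval_eq_sum_of_isHomogeneous_one hF.pderiv v
  have hS (v w : Fin 3 → ℂ) : Matrix.toLinearMap₂' ℂ H v w =
      ∑ i, ∑ j, v i * H i j * w j := by
    simp [Matrix.toLinearMap₂'_apply, mul_comm, mul_left_comm]
  have hT (v w : Fin 3 → ℂ) :
      eval w (tangentForm F v) = Matrix.toLinearMap₂' ℂ H v w := by
    rw [hS]
    simp only [tangentForm, map_add, map_mul, eval_C, eval_X, hpderiv, Fin.sum_univ_three]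
    ring
  refine ⟨Matrix.toLinearMap₂' ℂ H, fun v w => ?_, fun v => ?_, hT⟩
  · rw [hS, hS, Finset.sum_comm]
    exact Finset.sum_congr rfl fun i _ => Finset.sum_congr rfl fun j _ => by
      rw [hsymm j i]; ring
  · have h := congrArg (eval v) hF.sum_X_mul_pderiv
    simp only [Fin.sum_univ_three, map_add, map_mul, eval_X, nsmul_eq_mul, Nat.cast_ofNat,
      map_ofNat] at h
    rw [← hT, tangentForm]
    simp only [map_add, map_mul, eval_C, eval_X]
    linear_combination h

/-- Representatives of three non-collinear points span `ℂ³`. -/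
lemma exists_combination_of_not_collin {A B C : ProjPlane} (h : ¬ Collin {A, B, C})
    (w : Fin 3 → ℂ) : ∃ p q r : ℂ, w = p • A.rep + q • B.rep + r • C.rep := by
  set M : Matrix (Fin 3) (Fin 3) ℂ := Matrix.of ![A.rep, B.rep, C.rep] with hM
  have hdet : M.det ≠ 0 := by
    intro h0
    obtain ⟨l, hl0, hl⟩ := Matrix.exists_mulVec_eq_zero_iff.2 h0
    refine h ⟨∑ i, MvPolynomial.C (l i) * X i, fun hL => hl0 ?_,
      IsHomogeneous.sum _ _ _ fun i _ => isHomogeneous_C_mul_X _ _, ?_⟩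
    · funext k
      simpa [Pi.single_apply] using congrArg (eval (Pi.single k (1 : ℂ))) hL
    · have key (i : Fin 3) : ∑ j, l j * M i j = 0 := by
        simpa [Matrix.mulVec, dotProduct, mul_comm] using congrFun hl i
      rintro p (rfl | rfl | rfl)
      · simpa [VanishesAt, hM] using key 0
      · simpa [VanishesAt, hM] using key 1
      · simpa [VanishesAt, hM] using key 2
  have hw : Matrix.vecMul (Matrix.vecMul w M⁻¹) M = w := by
    rw [Matrix.vecMul_vecMul, Matrix.nonsing_inv_mul _ (isUnit_iff_ne_zero.2 hdet),
      Matrix.vecMul_one]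
  refine ⟨Matrix.vecMul w M⁻¹ 0, Matrix.vecMul w M⁻¹ 1, Matrix.vecMul w M⁻¹ 2, ?_⟩
  funext k
  conv_lhs => rw [← hw]
  simp only [Matrix.vecMul, dotProduct, Fin.sum_univ_three]
  simp [hM]

/-- A line through two of three non-collinear points misses the third. -/
lemma eval_ne_zero_of_not_collin {L : Poly3} {A B C : ProjPlane} (hL : IsLineThrough L A B)
    (h : ¬ Collin {A, B, C}) : eval C.rep L ≠ 0 := by
  refine fun hC => h ⟨L, hL.1, hL.2.1, ?_⟩
  rintro p (rfl | rfl | rfl)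
  exacts [hL.2.2.1, hL.2.2.2, hC]

/-- For a quadrilateral `ABCD` inscribed in an irreducible conic `𝒞`, the points
`M = l(AD) ∩ l(BC)`, `N = l(AB) ∩ l(CD)`, `P` (intersection of the tangents to `𝒞` at
`A` and `C`) and `Q` (intersection of the tangents at `B` and `D`) are collinear. -/
theorem quadrilateral_tangents_collinear (A B C D : ProjPlane)
    (hdist : ([A, B, C, D] : List ProjPlane).Pairwise (· ≠ ·))
    (hn3 : NoThreeCollinear {A, B, C, D})
    (F : Poly3) (hFh : F.IsHomogeneous 2) (hFirr : Irreducible F)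
    (honF : ∀ p ∈ [A, B, C, D], VanishesAt F p)
    (lAD lBC lAB lCD : Poly3)
    (hlAD : IsLineThrough lAD A D) (hlBC : IsLineThrough lBC B C)
    (hlAB : IsLineThrough lAB A B) (hlCD : IsLineThrough lCD C D)
    (hne₁ : ¬ ProportionalTo lAD lBC) (hne₂ : ¬ ProportionalTo lAB lCD)
    (M N : ProjPlane)
    (hM : VanishesAt lAD M ∧ VanishesAt lBC M)
    (hN : VanishesAt lAB N ∧ VanishesAt lCD N)
    (htA : tangentForm F A.rep ≠ 0) (htB : tangentForm F B.rep ≠ 0)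
    (htC : tangentForm F C.rep ≠ 0) (htD : tangentForm F D.rep ≠ 0)
    (htAC : ¬ ProportionalTo (tangentForm F A.rep) (tangentForm F C.rep))
    (htBD : ¬ ProportionalTo (tangentForm F B.rep) (tangentForm F D.rep))
    (P Q : ProjPlane)
    (hP : VanishesAt (tangentForm F A.rep) P ∧ VanishesAt (tangentForm F C.rep) P)
    (hQ : VanishesAt (tangentForm F B.rep) Q ∧ VanishesAt (tangentForm F D.rep) Q) :
    Collin {M, N, P, Q} := by
  simp only [List.pairwise_cons, List.mem_cons, List.not_mem_nil, or_false, forall_eq_or_imp,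
    forall_eq] at hdist honF
  obtain ⟨⟨hAB, hAC, hAD⟩, ⟨hBC, hBD⟩, hCD, -⟩ := hdist
  have nABC : ¬ Collin {A, B, C} := hn3 A B C (by simp) (by simp) (by simp) hAB hAC hBC
  have nABD : ¬ Collin {A, B, D} := hn3 A B D (by simp) (by simp) (by simp) hAB hAD hBD
  have nBCA : ¬ Collin {B, C, A} :=
    hn3 B C A (by simp) (by simp) (by simp) hBC hAB.symm hAC.symm
  have nBCD : ¬ Collin {B, C, D} := hn3 B C D (by simp) (by simp) (by simp) hBC hBD hCD
  have nADB : ¬ Collin {A, D, B} := hn3 A D B (by simp) (by simp) (by simp) hAD hAB hBD.symm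
  have nCDB : ¬ Collin {C, D, B} :=
    hn3 C D B (by simp) (by simp) (by simp) hCD hBC.symm hBD.symm
  have eBCA := eval_ne_zero_of_not_collin hlBC nBCA
  have eBCD := eval_ne_zero_of_not_collin hlBC nBCD
  have eABC := eval_ne_zero_of_not_collin hlAB nABC
  have eABD := eval_ne_zero_of_not_collin hlAB nABD
  have eADB := eval_ne_zero_of_not_collin hlAD nADB
  have eCDB := eval_ne_zero_of_not_collin hlCD nCDB
  obtain ⟨-, hAD1, hADA, hADD⟩ := hlAD
  obtain ⟨-, hBC1, hBCB, hBCC⟩ := hlBC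
  obtain ⟨-, hAB1, hABA, hABB⟩ := hlAB
  obtain ⟨-, hCD1, hCDC, hCDD⟩ := hlCD
  obtain ⟨fAD, hfAD⟩ := exists_linearMap_eval hAD1
  obtain ⟨fBC, hfBC⟩ := exists_linearMap_eval hBC1
  obtain ⟨fAB, hfAB⟩ := exists_linearMap_eval hAB1
  obtain ⟨fCD, hfCD⟩ := exists_linearMap_eval hCD1
  obtain ⟨S, hsymm, hSF, hST⟩ := exists_polar_form hFh
  obtain ⟨α, β, γ, hd⟩ := exists_combination_of_not_collin nABC D.rep
  obtain ⟨m₁, m₂, m₃, hm⟩ := exists_combination_of_not_collin nABC M.rep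
  obtain ⟨n₁, n₂, n₃, hn⟩ := exists_combination_of_not_collin nABC N.rep
  simp only [hfAD, hfBC, hfAB, hfCD] at eBCA eBCD eABC eABD eADB eCDB
  simp only [VanishesAt, hfAD, hfBC, hfAB, hfCD] at hADA hADD hBCB hBCC hABA hABB hCDC hCDD
  simp only [VanishesAt, hfAD, hfBC, hfAB, hfCD, hST] at honF hM hN hP hQ
  have SAA : S A.rep A.rep = 0 := by rw [hSF, honF.1, mul_zero]
  have SBB : S B.rep B.rep = 0 := by rw [hSF, honF.2.1, mul_zero]
  have SCC : S C.rep C.rep = 0 := by rw [hSF, honF.2.2.1, mul_zero]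
  have SDD : S D.rep D.rep = 0 := by rw [hSF, honF.2.2.2, mul_zero]
  have SBA := hsymm B.rep A.rep
  have SCA := hsymm C.rep A.rep
  have SCB := hsymm C.rep B.rep
  have hQD := hQ.2
  simp only [hd, hm, hn, map_add, map_smul, LinearMap.add_apply, LinearMap.smul_apply,
    smul_eq_mul, hADA, hBCB, hBCC, hABA, hABB, hCDC, SAA, SBB, SCC, SBA, SCA, SCB, mul_zero,
    add_zero, zero_add] at SDD hADD hCDD eBCD eABD hM hN hQD
  have hα : α ≠ 0 := left_ne_zero_of_mul eBCD
  have hγ : γ ≠ 0 := left_ne_zero_of_mul eABD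
  have hconic : α * β * S A.rep B.rep + α * γ * S A.rep C.rep + β * γ * S B.rep C.rep = 0 := by
    linear_combination SDD / 2
  have hm₁ : m₁ = 0 := (mul_eq_zero.1 hM.2).resolve_right eBCA
  have hn₃ : n₃ = 0 := (mul_eq_zero.1 hN.1).resolve_right eABC
  subst hm₁ hn₃
  have hm₂₃ : γ * m₂ - β * m₃ = 0 := by
    refine (mul_eq_zero.1 ?_).resolve_right eADB
    linear_combination γ * hM.1 - m₃ * hADD
  have hn₁₂ : α * n₂ - β * n₁ = 0 := by
    refine (mul_eq_zero.1 ?_).resolve_right eCDB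
    linear_combination α * hN.2 - n₁ * hCDD
  have eval_polar (w : Fin 3 → ℂ) :
      eval w (α • tangentForm F A.rep + γ • tangentForm F C.rep) =
        α * S A.rep w + γ * S C.rep w := by
    simp only [map_add, smul_eval, hST]
  -- the line is the polar of the intersection point of the diagonals
  refine ⟨α • tangentForm F A.rep + γ • tangentForm F C.rep, fun h0 => htAC ?_, ?_, ?_⟩
  · refine ⟨-(α / γ), neg_ne_zero.2 (div_ne_zero hα hγ), ?_⟩
    rw [← smul_right_injective _ hγ |>.eq_iff, smul_smul, mul_neg, mul_div_cancel₀ _ hγ,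
      neg_smul]
    exact eq_neg_of_add_eq_zero_right h0
  · simp only [smul_eq_C_mul]
    exact ((isHomogeneous_tangentForm F A.rep).C_mul α).add
      ((isHomogeneous_tangentForm F C.rep).C_mul γ)
  · rintro p (rfl | rfl | rfl | rfl)
    · rw [VanishesAt, eval_polar, hm]
      simp only [map_add, map_smul, smul_eq_mul, SAA, SCC, SCA, SCB]
      refine (mul_eq_zero.1 ?_).resolve_left hγ
      linear_combination m₃ * hconic
        + (α * S A.rep B.rep + γ * S B.rep C.rep) * hm₂₃
    · rw [VanishesAt, eval_polar, hn]
      simp only [map_add, map_smul, smul_eq_mul, SAA, SCC, SCA, SCB]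
      refine (mul_eq_zero.1 ?_).resolve_left hα
      linear_combination n₁ * hconic + (α * S A.rep B.rep + γ * S B.rep C.rep) * hn₁₂
    · rw [VanishesAt, eval_polar, hP.1, hP.2, mul_zero, mul_zero, add_zero]
    · rw [VanishesAt, eval_polar]
      linear_combination hQD - β * hQ.1
end
end
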